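/- Let G be a graph in which x and y are distinct non-adjacent vertices with exactly two internally vertex-disjoint x-y paths but no three pairwise internally vertex-disjoint x-y paths (i.e., κ_G(x,y) = 2). Suppose the edge f = (u₁,v₁) participates in every x-y flow of value 2 in G, and let {P₁, P₂} be an x-y flow of value 2 with f an edge of P₁. Then there exists a vertex v on P₂ (with v ∉ {x,y}) such that {f, v} is a mixed x-y cut in G, i.e., deleting the edge f and the vertex v from G destroys all x-y paths. -/

import Mathlib

open SimpleGraph

/-- Two walks with the same endpoints are internally vertex-disjoint if every
common vertex is one of the endpoints. -/
def IntDisjoint {V : Type*} {G : SimpleGraph V} {x y : V} (p q : G.Walk x y) : Prop :=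
  ∀ v, v ∈ p.support → v ∈ q.support → v = x ∨ v = y


theorem first_hit {V : Type*} {G : SimpleGraph V} (S : Set V) {a b : V} (r : G.Walk a b)
    (hb : b ∈ S) : ∃ z ∈ S, ∃ p : G.Walk a z, (∀ c ∈ p.support, c ∈ r.support) ∧
      ∀ c ∈ p.support, c ∈ S → c = z := by
  induction r with
  | nil => exact ⟨_, hb, Walk.nil, by simp, by simp⟩
  | @cons a d b h q ih =>
    by_cases ha : a ∈ S
    · exact ⟨a, ha, Walk.nil, by simp, by simp⟩
    · obtain ⟨z, hz, p, h1, h2⟩ := ih hb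
      refine ⟨z, hz, Walk.cons h p, ?_, ?_⟩
      · intro c hc
        rw [Walk.support_cons, List.mem_cons] at hc ⊢
        exact hc.imp id (h1 c)
      · intro c hc hcS
        rw [Walk.support_cons, List.mem_cons] at hc
        rcases hc with rfl | hc
        · exact absurd hcS ha
        · exact h2 c hc hcS

theorem step_aux {V : Type*} {G : SimpleGraph V} {x w w' z : V}
    (A B : G.Walk x w) (hA : A.IsPath) (hd : IntDisjoint A B) (h : G.Adj w w')
    (hzA : z ∈ A.support) (hzw : z ≠ w) (p : G.Walk w' z)
    (hp : ∀ c ∈ p.support, c ∈ B.support → c = z) :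
    ∃ A' B' : G.Walk x w', A'.IsPath ∧ B'.IsPath ∧ IntDisjoint A' B' := by
  classical
  refine ⟨((A.takeUntil z hzA).append p.reverse).bypass, (B.concat h).bypass,
    Walk.bypass_isPath _, Walk.bypass_isPath _, ?_⟩
  intro c hc1 hc2
  replace hc1 := Walk.support_bypass_subset _ hc1
  replace hc2 := Walk.support_bypass_subset _ hc2
  rw [Walk.mem_support_append_iff, Walk.support_reverse, List.mem_reverse] at hc1
  rw [Walk.support_concat] at hc2
  simp only [List.concat_eq_append, List.mem_append, List.mem_singleton] at hc2
  rcases hc2 with hcB | rfl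
  · rcases hc1 with hcA | hcp
    · rcases hd c (Walk.support_takeUntil_subset _ _ hcA) hcB with rfl | rfl
      · exact Or.inl rfl
      · exact absurd hcA (Walk.endpoint_notMem_support_takeUntil hA hzA hzw.symm)
    · obtain rfl := hp c hcp hcB
      exact Or.inl ((hd c hzA hcB).resolve_right hzw)
  · exact Or.inr rfl

theorem step {V : Type*} {G : SimpleGraph V} {x w w' : V}
    (A B : G.Walk x w) (hA : A.IsPath) (hB : B.IsPath) (hd : IntDisjoint A B) (h : G.Adj w w')
    (R : G.Walk w' x) (hR : w ∉ R.support) :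
    ∃ A' B' : G.Walk x w', A'.IsPath ∧ B'.IsPath ∧ IntDisjoint A' B' := by
  obtain ⟨z, hz, p, h1, h2⟩ := first_hit {c | c ∈ A.support ∨ c ∈ B.support} R
    (Or.inl A.start_mem_support)
  have hzw : z ≠ w := by
    rintro rfl
    exact hR (h1 _ p.end_mem_support)
  rcases hz with hz | hz
  · exact step_aux A B hA hd h hz hzw p fun c hc hc' => h2 c hc (Or.inr hc')
  · exact step_aux B A hB (fun v h h' => hd v h' h) h hz hzw p
      fun c hc hc' => h2 c hc (Or.inl hc')

theorem chain {V : Type*} {G : SimpleGraph V} {x y w : V}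
    (hcut : ∀ v, v ≠ x → v ≠ y → ∃ p : G.Walk x y, v ∉ p.support)
    (q : G.Walk w y) (hq : q.IsPath) (hx : x ∉ q.support)
    (A B : G.Walk x w) (hA : A.IsPath) (hB : B.IsPath) (hd : IntDisjoint A B) :
    ∃ A' B' : G.Walk x y, A'.IsPath ∧ B'.IsPath ∧ IntDisjoint A' B' := by
  induction q with
  | nil => exact ⟨A, B, hA, hB, hd⟩
  | @cons w w' y h q ih =>
    rw [Walk.cons_isPath_iff] at hq
    rw [Walk.support_cons, List.mem_cons, not_or] at hx
    obtain ⟨R, hR⟩ := hcut w (Ne.symm hx.1) (by rintro rfl; exact hq.2 q.end_mem_support)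
    obtain ⟨A', B', hA', hB', hd'⟩ := step A B hA hB hd h (q.append R.reverse) (by
      rw [Walk.mem_support_append_iff, Walk.support_reverse, List.mem_reverse]
      exact not_or.2 ⟨hq.2, hR⟩)
    exact ih hcut hq.1 hx.2 A' B' hA' hB' hd'

theorem menger_two {V : Type*} {G : SimpleGraph V} {x y : V} (hxy : x ≠ y)
    (hcut : ∀ v, v ≠ x → v ≠ y → ∃ p : G.Walk x y, v ∉ p.support)
    (q : G.Walk x y) :
    ∃ A' B' : G.Walk x y, A'.IsPath ∧ B'.IsPath ∧ IntDisjoint A' B' := by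
  classical
  have hq := q.bypass_isPath
  generalize q.bypass = r at hq
  cases r with
  | nil => exact absurd rfl hxy
  | cons h r =>
    rw [Walk.cons_isPath_iff] at hq
    refine chain hcut r hq.1 hq.2 h.toWalk h.toWalk ?_ ?_ ?_
    · simp [h.ne]
    · simp [h.ne]
    · intro v hv _
      simpa using hv

theorem stmt8 {V : Type*} (G : SimpleGraph V) (x y : V) (hxy : x ≠ y)
    (hnadj : ¬ G.Adj x y)
    -- κ_G(x,y) = 2 : there is no x-y flow of value 3 ...
    (hno3 : ¬ ∃ Q : Fin 3 → G.Walk x y, (∀ i, (Q i).IsPath) ∧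
      ∀ i j, i ≠ j → IntDisjoint (Q i) (Q j))
    -- the edge f = (u₁, v₁)
    (u₁ v₁ : V) (hadj : G.Adj u₁ v₁)
    -- f participates in every x-y flow of value 2 in G
    (hpart : ∀ Q₁ Q₂ : G.Walk x y, Q₁.IsPath → Q₂.IsPath → IntDisjoint Q₁ Q₂ →
      s(u₁, v₁) ∈ Q₁.edges ∨ s(u₁, v₁) ∈ Q₂.edges)
    -- ... and {P₁, P₂} is an x-y flow of value 2 with f an edge of P₁
    (P₁ P₂ : G.Walk x y) (hP₁ : P₁.IsPath) (hP₂ : P₂.IsPath)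
    (hdisj : IntDisjoint P₁ P₂) (hf : s(u₁, v₁) ∈ P₁.edges) :
    ∃ v ∈ P₂.support, v ≠ x ∧ v ≠ y ∧
      ∀ p : G.Walk x y, s(u₁, v₁) ∈ p.edges ∨ v ∈ p.support := by
  have hf2 : s(u₁, v₁) ∉ P₂.edges := by
    intro h2
    have hu := hdisj u₁ (P₁.fst_mem_support_of_mem_edges hf) (P₂.fst_mem_support_of_mem_edges h2)
    have hv := hdisj v₁ (P₁.snd_mem_support_of_mem_edges hf) (P₂.snd_mem_support_of_mem_edges h2)
    rcases hu with rfl | rfl <;> rcases hv with rfl | rfl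
    · exact hadj.ne rfl
    · exact hnadj hadj
    · exact hnadj hadj.symm
    · exact hadj.ne rfl
  by_contra hcon
  push Not at hcon
  have hle : G.deleteEdges {s(u₁, v₁)} ≤ G := G.deleteEdges_le _
  have hnot : ∀ p : (G.deleteEdges {s(u₁, v₁)}).Walk x y, s(u₁, v₁) ∉ (p.mapLe hle).edges := by
    intro p hp
    rw [Walk.edges_mapLe_eq_edges] at hp
    have := p.edges_subset_edgeSet hp
    simp at this
  have hconv : ∀ p : G.Walk x y, s(u₁, v₁) ∉ p.edges →
      ∃ p' : (G.deleteEdges {s(u₁, v₁)}).Walk x y, p'.support = p.support := by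
    intro p hp
    exact ⟨p.transfer _ (by
      intro e he
      rw [edgeSet_deleteEdges]
      refine ⟨p.edges_subset_edgeSet he, ?_⟩
      rintro rfl
      exact hp he), Walk.support_transfer _ _⟩
  obtain ⟨q, hq⟩ := hconv P₂ hf2
  obtain ⟨A, B, hA, hB, hd⟩ := menger_two (G := G.deleteEdges {s(u₁, v₁)}) hxy (by
    intro v hvx hvy
    by_cases hv : v ∈ P₂.support
    · obtain ⟨p, hp1, hp2⟩ := hcon v hv hvx hvy
      obtain ⟨p', hp'⟩ := hconv p hp1
      exact ⟨p', by rwa [hp']⟩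
    · exact ⟨q, by rwa [hq]⟩) q
  rcases hpart (A.mapLe hle) (B.mapLe hle) (hA.mapLe hle) (hB.mapLe hle) (by
    intro v h1 h2
    rw [Walk.support_mapLe_eq_support] at h1 h2
    exact hd v h1 h2) with h | h
  · exact hnot _ h
  · exact hnot _ h
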